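/- arXiv:math/0210302 — 5 statements merged into one kernel-verified Lean document; each statement's English description precedes it below -/
import Mathlib

section
/- For every φ in the closed interval [0, 1], I₁(φ) + I₂(φ) ≤ 1. -/
open Real intervalIntegral

noncomputable def I₁ (φ : ℝ) : ℝ :=
  (4 / Real.pi) * (1 / (1 + φ ^ 3)) * (Real.sqrt 2 / 2) *
    ((2 + 2 * φ ^ 3 - 3 * φ ^ 2) *
        Real.arcsin (φ / Real.sqrt (2 + 2 * φ ^ 3 - 3 * φ ^ 2))
      - φ * Real.sqrt (2 + 2 * φ ^ 3 - 4 * φ ^ 2))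

noncomputable def I₂ (φ : ℝ) : ℝ :=
  (4 / Real.pi) * (1 / (1 + φ ^ 3)) *
    ∫ s in φ..1, s ^ ((5:ℝ)/2) / Real.sqrt ((1 - s) * (s ^ 2 + s - φ ^ 3))

/-- The function `x ↦ arcsin x - x √(1 - x²)`, a primitive of `2 x² / √(1 - x²)`. -/
noncomputable def segmentArea (x : ℝ) : ℝ := arcsin x - x * √(1 - x ^ 2)

/-- The function `x ↦ arcsin x + √(1 - x²) / (1 + x)`, a primitive of
`x / ((1 + x) √(1 - x²))`. -/
noncomputable def arcsinAddTan (x : ℝ) : ℝ := arcsin x + √(1 - x ^ 2) / (1 + x)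

theorem continuous_segmentArea : Continuous segmentArea := by
  unfold segmentArea
  fun_prop

theorem continuousOn_arcsinAddTan : ContinuousOn arcsinAddTan (Set.Icc 0 1) := by
  unfold arcsinAddTan
  refine continuous_arcsin.continuousOn.add (ContinuousOn.div (by fun_prop) (by fun_prop) ?_)
  intro x hx
  have := hx.1
  positivity

theorem hasDerivAt_sqrt_one_sub_sq {x : ℝ} (h0 : 0 ≤ x) (h1 : x < 1) :
    HasDerivAt (fun y : ℝ => √(1 - y ^ 2)) (-x / √(1 - x ^ 2)) x := by
  have hpos : 0 < 1 - x ^ 2 := by nlinarith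
  have h : HasDerivAt (fun y : ℝ => 1 - y ^ 2) (-(2 * x)) x := by
    simpa using (hasDerivAt_pow 2 x).const_sub 1
  convert h.sqrt hpos.ne' using 1
  have := (Real.sqrt_pos.2 hpos).ne'
  field_simp

theorem hasDerivAt_segmentArea {x : ℝ} (h0 : 0 ≤ x) (h1 : x < 1) :
    HasDerivAt segmentArea (2 * x ^ 2 / √(1 - x ^ 2)) x := by
  have hpos : 0 < 1 - x ^ 2 := by nlinarith
  have hs := (Real.sqrt_pos.2 hpos).ne'
  have hsq := Real.sq_sqrt hpos.le
  have h := (hasDerivAt_arcsin (by linarith : x ≠ -1) h1.ne).sub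
    ((hasDerivAt_id x).mul (hasDerivAt_sqrt_one_sub_sq h0 h1))
  refine h.congr_deriv ?_
  simp only [id]
  field_simp
  rw [hsq]
  ring

theorem hasDerivAt_arcsinAddTan {x : ℝ} (h0 : 0 ≤ x) (h1 : x < 1) :
    HasDerivAt arcsinAddTan (x / ((1 + x) * √(1 - x ^ 2))) x := by
  have hpos : 0 < 1 - x ^ 2 := by nlinarith
  have hs := (Real.sqrt_pos.2 hpos).ne'
  have hsq := Real.sq_sqrt hpos.le
  have hx : 1 + x ≠ 0 := by positivity
  have h := (hasDerivAt_arcsin (by linarith : x ≠ -1) h1.ne).add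
    ((hasDerivAt_sqrt_one_sub_sq h0 h1).div ((hasDerivAt_id x).const_add 1) hx)
  refine h.congr_deriv ?_
  simp only [id]
  field_simp
  rw [hsq]
  ring

theorem segmentArea_mul_le {k x : ℝ} (hk0 : 0 ≤ k) (hk1 : k ≤ 1) (hx0 : 0 ≤ x) (hx1 : x ≤ 1) :
    segmentArea (k * x) ≤ k ^ 3 * segmentArea x := by
  have hmono : MonotoneOn (fun y => k ^ 3 * segmentArea y - segmentArea (k * y))
      (Set.Icc 0 1) := by
    refine monotoneOn_of_hasDerivWithinAt_nonneg (convex_Icc 0 1)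
      (f' := fun y => k ^ 3 * (2 * y ^ 2 / √(1 - y ^ 2)) -
        2 * (k * y) ^ 2 / √(1 - (k * y) ^ 2) * k) ?_ ?_ ?_
    · have := continuous_segmentArea
      fun_prop
    · intro y hy
      rw [interior_Icc] at hy
      have hky : k * y < 1 := by nlinarith [hy.1, hy.2]
      have h1 := (hasDerivAt_segmentArea hy.1.le hy.2).const_mul (k ^ 3)
      have h2 := (hasDerivAt_segmentArea (mul_nonneg hk0 hy.1.le) hky).comp y
        (by simpa using (hasDerivAt_id y).const_mul k)
      exact (h1.sub h2).hasDerivWithinAt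
    · intro y hy
      rw [interior_Icc] at hy
      have hpos : 0 < 1 - y ^ 2 := by nlinarith [hy.1, hy.2]
      have hle : √(1 - y ^ 2) ≤ √(1 - (k * y) ^ 2) := by
        apply Real.sqrt_le_sqrt
        rw [mul_pow]
        nlinarith [sq_nonneg y, pow_le_one₀ hk0 hk1 (n := 2)]
      have h : 2 * k ^ 3 * y ^ 2 / √(1 - (k * y) ^ 2) ≤ 2 * k ^ 3 * y ^ 2 / √(1 - y ^ 2) :=
        div_le_div_of_nonneg_left (by positivity) (Real.sqrt_pos.2 hpos) hle
      have e1 : k ^ 3 * (2 * y ^ 2 / √(1 - y ^ 2)) = 2 * k ^ 3 * y ^ 2 / √(1 - y ^ 2) := by ring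
      have e2 : 2 * (k * y) ^ 2 / √(1 - (k * y) ^ 2) * k =
        2 * k ^ 3 * y ^ 2 / √(1 - (k * y) ^ 2) := by ring
      rw [e1, e2]
      linarith
  have h := hmono (Set.left_mem_Icc.2 zero_le_one) ⟨hx0, hx1⟩ hx0
  simp only [segmentArea, mul_zero, arcsin_zero, zero_mul, sub_zero] at h ⊢
  linarith

theorem segmentArea_le {x : ℝ} (hx0 : 0 ≤ x) (hx1 : x ≤ 1) :
    segmentArea x ≤ x ^ 3 * (π / 2) := by
  have h := segmentArea_mul_le hx0 hx1 zero_le_one le_rfl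
  simpa [segmentArea] using h

theorem monotoneOn_arcsinAddTan : MonotoneOn arcsinAddTan (Set.Icc 0 1) := by
  refine monotoneOn_of_hasDerivWithinAt_nonneg (convex_Icc 0 1)
    (f' := fun x => x / ((1 + x) * √(1 - x ^ 2))) continuousOn_arcsinAddTan ?_ ?_
  · intro x hx
    rw [interior_Icc] at hx
    exact (hasDerivAt_arcsinAddTan hx.1.le hx.2).hasDerivWithinAt
  · intro x hx
    rw [interior_Icc] at hx
    have := hx.1
    positivity

theorem rpow_div_sqrt_le {s c : ℝ} (hs0 : 0 < s) (hs1 : s < 1) (hc0 : 0 ≤ c)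
    (hc : 2 * c ≤ s * (s + 1)) :
    s ^ ((5 : ℝ) / 2) / √((1 - s) * (s ^ 2 + s - c)) ≤
      1 / 2 * (2 * s ^ 2 / √(1 - s ^ 2)) +
        5 / 6 * c * (s / ((1 + s) * √(1 - s ^ 2))) := by
  have hp : 0 < 1 - s := by linarith
  have hm : 0 < s * (s + 1) := by positivity
  obtain ⟨u, rfl⟩ : ∃ u, c = u * (s * (s + 1)) := ⟨c / (s * (s + 1)), by field_simp⟩
  have hu0 : 0 ≤ u := nonneg_of_mul_nonneg_left hc0 hm
  have hu1 : u ≤ 1 / 2 := by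
    by_contra! h
    nlinarith
  have hu : 0 < 1 - u := by linarith
  have hw : 0 < √(1 - s ^ 2) := Real.sqrt_pos.2 (by nlinarith)
  have hr : 0 < √(1 - u) := Real.sqrt_pos.2 hu
  have hss : 0 < √s := Real.sqrt_pos.2 hs0
  have e1 : s ^ ((5 : ℝ) / 2) = s ^ 2 * √s := by
    rw [Real.sqrt_eq_rpow, ← Real.rpow_natCast s 2, ← Real.rpow_add hs0]
    norm_num
  have e2 : √((1 - s) * (s ^ 2 + s - u * (s * (s + 1)))) = √s * √(1 - s ^ 2) * √(1 - u) := by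
    rw [← Real.sqrt_mul hs0.le, ← Real.sqrt_mul (by nlinarith)]
    congr 1
    ring
  have e3 : s ^ 2 * √s / (√s * √(1 - s ^ 2) * √(1 - u)) =
      s ^ 2 / √(1 - s ^ 2) * (1 / √(1 - u)) := by
    field_simp
  have e4 : 1 / 2 * (2 * s ^ 2 / √(1 - s ^ 2)) +
        5 / 6 * (u * (s * (s + 1))) * (s / ((1 + s) * √(1 - s ^ 2))) =
      s ^ 2 / √(1 - s ^ 2) * (1 + 5 / 6 * u) := by
    field_simp
    ring
  rw [e1, e2, e3, e4]
  refine mul_le_mul_of_nonneg_left ?_ (by positivity)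
  rw [div_le_iff₀ hr]
  have hsq : (1 : ℝ) ≤ ((1 + 5 / 6 * u) * √(1 - u)) ^ 2 := by
    rw [mul_pow, Real.sq_sqrt hu.le]
    have : 0 ≤ u * (2 / 3 - 35 / 36 * u - 25 / 36 * u ^ 2) :=
      mul_nonneg hu0 (by nlinarith)
    nlinarith
  nlinarith [mul_pos (by positivity : 0 < 1 + 5 / 6 * u) hr]

theorem integral_rpow_div_sqrt_le {φ : ℝ} (h0 : 0 ≤ φ) (h1 : φ ≤ 1) :
    ∫ s in φ..1, s ^ ((5 : ℝ) / 2) / √((1 - s) * (s ^ 2 + s - φ ^ 3)) ≤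
      1 / 2 * (segmentArea 1 - segmentArea φ) +
        5 / 6 * φ ^ 3 * (arcsinAddTan 1 - arcsinAddTan φ) := by
  set g : ℝ → ℝ := fun s => 1 / 2 * (2 * s ^ 2 / √(1 - s ^ 2)) +
        5 / 6 * φ ^ 3 * (s / ((1 + s) * √(1 - s ^ 2))) with hg
  set P : ℝ → ℝ := fun s => 1 / 2 * segmentArea s + 5 / 6 * φ ^ 3 * arcsinAddTan s with hP
  have hc : 0 ≤ φ ^ 3 := by positivity
  have hPc : ContinuousOn P (Set.Icc φ 1) :=
    (continuous_segmentArea.continuousOn.const_smul (1 / 2 : ℝ)).add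
      ((continuousOn_arcsinAddTan.mono (Set.Icc_subset_Icc_left h0)).const_smul (5 / 6 * φ ^ 3))
  have hPd : ∀ s ∈ Set.Ioo φ 1, HasDerivAt P (g s) s := fun s hs =>
    ((hasDerivAt_segmentArea (h0.trans hs.1.le) hs.2).const_mul _).add
      ((hasDerivAt_arcsinAddTan (h0.trans hs.1.le) hs.2).const_mul _)
  have hgn : ∀ s ∈ Set.Ioo φ 1, 0 ≤ g s := by
    intro s hs
    have : 0 < s := h0.trans_lt hs.1
    simp only [hg]
    positivity
  have hgi : MeasureTheory.IntegrableOn g (Set.Ioc φ 1) :=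
    integrableOn_deriv_of_nonneg hPc hPd hgn
  have hFTC : ∫ s in φ..1, g s = P 1 - P φ :=
    integral_eq_sub_of_hasDerivAt_of_le h1 hPc hPd
      ((intervalIntegrable_iff_integrableOn_Ioc_of_le h1).2 hgi)
  have hle : ∫ s in φ..1, s ^ ((5 : ℝ) / 2) / √((1 - s) * (s ^ 2 + s - φ ^ 3)) ≤
      ∫ s in φ..1, g s := by
    rw [integral_of_le h1, integral_of_le h1, MeasureTheory.integral_Ioc_eq_integral_Ioo,
      MeasureTheory.integral_Ioc_eq_integral_Ioo]
    refine MeasureTheory.integral_mono_of_nonneg ?_ (hgi.mono_set Set.Ioo_subset_Ioc_self) ?_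
    · filter_upwards [MeasureTheory.ae_restrict_mem measurableSet_Ioo] with s hs
      have : 0 < s := h0.trans_lt hs.1
      simp only [Pi.zero_apply]
      positivity
    · filter_upwards [MeasureTheory.ae_restrict_mem measurableSet_Ioo] with s hs
      have hs0 : 0 < s := h0.trans_lt hs.1
      have h3 : φ ^ 3 ≤ s ^ 3 := pow_le_pow_left₀ h0 hs.1.le 3
      refine rpow_div_sqrt_le hs0 hs.2 hc ?_
      nlinarith [mul_pos hs0 (sub_pos.2 hs.2), mul_pos (mul_pos hs0 hs0) (sub_pos.2 hs.2)]
  rw [hFTC] at hle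
  simp only [hP] at hle
  linarith

theorem mul_arcsin_div_sqrt_sub_le {φ A : ℝ} (h0 : 0 ≤ φ) (h1 : φ ≤ 1) (hA : 1 ≤ A) :
    A * arcsin (φ / √A) - φ * √(A - φ ^ 2) ≤ 1 / √A * segmentArea φ := by
  have hA0 : 0 < A := by linarith
  have hr : 1 ≤ √A := Real.one_le_sqrt.2 hA
  have hr0 : 0 < √A := by linarith
  have hsq : √A ^ 2 = A := Real.sq_sqrt hA0.le
  have h := segmentArea_mul_le (k := 1 / √A) (x := φ) (by positivity)
    ((div_le_one hr0).2 hr) h0 h1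
  have e : √(A - φ ^ 2) = √A * √(1 - (φ / √A) ^ 2) := by
    rw [← Real.sqrt_mul hA0.le, div_pow, hsq]
    congr 1
    field_simp
  have e2 : A * segmentArea (φ / √A) = A * arcsin (φ / √A) - φ * √(A - φ ^ 2) := by
    rw [e, segmentArea]
    have : A * (φ / √A) = √A * φ := by
      field_simp
      rw [hsq, mul_comm]
    linear_combination -√(1 - (φ / √A) ^ 2) * this
  rw [one_div_mul_eq_div] at h
  rw [← e2]
  calc A * segmentArea (φ / √A) ≤ A * ((1 / √A) ^ 3 * segmentArea φ) :=
        mul_le_mul_of_nonneg_left h hA0.le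
    _ = 1 / √A * segmentArea φ := by
        have : A * (1 / √A) ^ 3 = 1 / √A := by
          field_simp
          exact hsq.symm
        rw [← mul_assoc, this]

theorem arcsinAddTan_one : arcsinAddTan 1 = π / 2 := by
  simp [arcsinAddTan]

theorem one_le_arcsinAddTan {φ : ℝ} (h0 : 0 ≤ φ) (h1 : φ ≤ 1) : 1 ≤ arcsinAddTan φ := by
  simpa [arcsinAddTan] using
    monotoneOn_arcsinAddTan (Set.left_mem_Icc.2 zero_le_one) ⟨h0, h1⟩ h0

theorem pi_div_six_add_le_arcsinAddTan {φ : ℝ} (h0 : 1 / 2 ≤ φ) (h1 : φ ≤ 1) :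
    π / 6 + 57 / 100 ≤ arcsinAddTan φ := by
  have h := monotoneOn_arcsinAddTan (a := 1 / 2) (by norm_num) ⟨by linarith, h1⟩ h0
  have ha : arcsin (1 / 2) = π / 6 := by
    rw [← Real.sin_pi_div_six]
    exact arcsin_sin (by linarith [pi_pos]) (by linarith [pi_pos])
  have hs : 171 / 200 ≤ √(1 - (1 / 2) ^ 2 : ℝ) := Real.le_sqrt_of_sq_le (by norm_num)
  have hd : 57 / 100 ≤ √(1 - (1 / 2) ^ 2 : ℝ) / (1 + 1 / 2) := by
    rw [le_div_iff₀ (by norm_num)]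
    linarith
  rw [arcsinAddTan, ha] at h
  linarith

theorem coeff_le {φ A : ℝ} (h0 : 0 ≤ φ) (h1 : φ ≤ 1) (hA : A = 2 + 2 * φ ^ 3 - 3 * φ ^ 2) :
    (√2 / √A - 1) * (π / 4) + 5 / 6 * (π / 2 - arcsinAddTan φ) ≤ π / 4 := by
  have hA1 : 1 ≤ A := by nlinarith [mul_nonneg (sq_nonneg (1 - φ)) h0, sq_nonneg (1 - φ)]
  have hpi := pi_pos
  have hpi' := pi_lt_d2
  rw [← Real.sqrt_div zero_le_two]
  rcases le_total φ (1 / 2) with h | h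
  · have hr : √(2 / A) ≤ 6 / 5 := by
      rw [Real.sqrt_le_left (by norm_num), div_le_iff₀ (by linarith)]
      nlinarith [mul_nonneg h0 (sub_nonneg.2 h), mul_nonneg h0 (mul_nonneg h0 (sub_nonneg.2 h))]
    nlinarith [one_le_arcsinAddTan h0 h1]
  · have hr : √(2 / A) ≤ 142 / 100 := by
      rw [Real.sqrt_le_left (by norm_num), div_le_iff₀ (by linarith)]
      nlinarith
    nlinarith [pi_div_six_add_le_arcsinAddTan h h1]

theorem I1_add_I2_le_one : ∀ φ ∈ Set.Icc (0:ℝ) 1, I₁ φ + I₂ φ ≤ 1 := by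
  rintro φ ⟨h0, h1⟩
  obtain ⟨A, hA⟩ : ∃ A, A = 2 + 2 * φ ^ 3 - 3 * φ ^ 2 := ⟨_, rfl⟩
  have hA1 : 1 ≤ A := by nlinarith [mul_nonneg (sq_nonneg (1 - φ)) h0, sq_nonneg (1 - φ)]
  have hA2 : A ≤ 2 := by nlinarith [mul_nonneg (sq_nonneg φ) (sub_nonneg.2 h1), sq_nonneg φ]
  have hc : 0 ≤ φ ^ 3 := by positivity
  have hpi := pi_pos
  have hI₁ := mul_arcsin_div_sqrt_sub_le h0 h1 hA1
  have hI₂ := integral_rpow_div_sqrt_le h0 h1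
  have hseg := segmentArea_le h0 h1
  have hratio : 1 ≤ √2 / √A := by
    rw [one_le_div (Real.sqrt_pos.2 (by linarith))]
    exact Real.sqrt_le_sqrt hA2
  have hone : segmentArea 1 = π / 2 := by simp [segmentArea]
  rw [arcsinAddTan_one, hone] at hI₂
  have hbound : √2 / 2 * (A * arcsin (φ / √A) - φ * √(A - φ ^ 2)) +
      (∫ s in φ..1, s ^ ((5 : ℝ) / 2) / √((1 - s) * (s ^ 2 + s - φ ^ 3))) ≤
        π / 4 * (1 + φ ^ 3) := by
    have b1 := mul_le_mul_of_nonneg_left hI₁ (by positivity : 0 ≤ √2 / 2)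
    have b2 : √2 / 2 * (1 / √A * segmentArea φ) = √2 / √A * segmentArea φ / 2 := by ring
    have b3 := mul_le_mul_of_nonneg_left hseg (sub_nonneg.2 hratio)
    have b4 := mul_le_mul_of_nonneg_left (coeff_le h0 h1 hA) hc
    linarith
  have hsplit : I₁ φ + I₂ φ = 4 / π * (1 / (1 + φ ^ 3)) *
      (√2 / 2 * (A * arcsin (φ / √A) - φ * √(A - φ ^ 2)) +
        ∫ s in φ..1, s ^ ((5 : ℝ) / 2) / √((1 - s) * (s ^ 2 + s - φ ^ 3))) := by
    have : A - φ ^ 2 = 2 + 2 * φ ^ 3 - 4 * φ ^ 2 := by rw [hA]; ring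
    rw [I₁, I₂, this, hA]
    ring
  rw [hsplit]
  calc _ ≤ 4 / π * (1 / (1 + φ ^ 3)) * (π / 4 * (1 + φ ^ 3)) :=
        mul_le_mul_of_nonneg_left hbound (by positivity)
    _ = 1 := by field_simp
end

section
/- For every φ in the closed interval [2/5, 4/5], E(φ) ≤ 1 + (125/434)·φ⁴. -/
noncomputable def E (φ : ℝ) : ℝ :=
  Real.sqrt (1 + φ) / Real.sqrt (1 + φ - φ ^ 2) - (1 / 2) * φ ^ 2 / (1 + φ)

/-- A bound for `1 / √(1 - x)` by its first-order Taylor polynomial plus a quadratic error. -/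
theorem one_le_sq_mul_one_sub {x t : ℝ} (hx₀ : 0 ≤ x) (hx₁ : x ≤ 1)
    (ht : 3 / 8 * x ^ 2 ≤ t * (1 - x)) : 1 ≤ (1 + x / 2 + t) ^ 2 * (1 - x) := by
  have h₁ : (2 + x) * (3 / 8 * x ^ 2) ≤ (2 + x) * (t * (1 - x)) :=
    mul_le_mul_of_nonneg_left ht (by linarith)
  have h₂ : 0 ≤ t ^ 2 * (1 - x) := mul_nonneg (sq_nonneg t) (by linarith)
  have h₃ : 0 ≤ x ^ 3 := pow_nonneg hx₀ 3
  linarith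

theorem E_le_on_second (φ : ℝ) (hφ : φ ∈ Set.Icc (2/5 : ℝ) (4/5)) :
    E φ ≤ 1 + (125 / 434) * φ ^ 4 := by
  obtain ⟨h₁, h₂⟩ := hφ
  have hD : 0 < 1 + φ := by linarith
  have hQ : 29 / 25 ≤ 1 + φ - φ ^ 2 := by nlinarith
  have hQ₀ : 0 < 1 + φ - φ ^ 2 := by linarith
  have hx : 1 - φ ^ 2 / (1 + φ) = (1 + φ - φ ^ 2) / (1 + φ) := by
    field_simp
  have key := one_le_sq_mul_one_sub (x := φ ^ 2 / (1 + φ)) (t := 125 / 434 * φ ^ 4)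
    (by positivity) (by rw [div_le_one hD]; linarith) (by
      have hprod : 3 / 8 ≤ 125 / 434 * ((1 + φ) * (1 + φ - φ ^ 2)) := by nlinarith
      have hscaled := mul_le_mul_of_nonneg_left hprod
        (show 0 ≤ φ ^ 4 / (1 + φ) ^ 2 by positivity)
      rw [hx]
      calc 3 / 8 * (φ ^ 2 / (1 + φ)) ^ 2 = φ ^ 4 / (1 + φ) ^ 2 * (3 / 8) := by rw [div_pow]; ring
        _ ≤ _ := hscaled
        _ = _ := by field_simp)
  have hsqrt : Real.sqrt (1 + φ) / Real.sqrt (1 + φ - φ ^ 2) ≤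
      1 + φ ^ 2 / (1 + φ) / 2 + 125 / 434 * φ ^ 4 := by
    rw [← Real.sqrt_div hD.le]
    refine Real.sqrt_le_iff.mpr ⟨by positivity, ?_⟩
    rw [hx, mul_div_assoc', le_div_iff₀ hD, one_mul] at key
    rwa [div_le_iff₀ hQ₀]
  have hhalf : 1 / 2 * φ ^ 2 / (1 + φ) = φ ^ 2 / (1 + φ) / 2 := by ring
  rw [E, hhalf]
  linarith
end

section
/- For every φ in the closed interval [0, 4/5], E(φ)·F(φ) ≤ π/4 + (π/16 − 1/3)·φ³. -/
noncomputable def F (φ : ℝ) : ℝ :=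
  Real.pi / 4 + (1 / 2) * φ * Real.sqrt (1 - φ ^ 2) - (1 / 2) * Real.arcsin φ

theorem hasDerivAt_F {x : ℝ} (h₀ : -1 < x) (h₁ : x < 1) :
    HasDerivAt F (-x ^ 2 / Real.sqrt (1 - x ^ 2)) x := by
  have hpos : 0 < 1 - x ^ 2 := by nlinarith
  have hs : 0 < Real.sqrt (1 - x ^ 2) := Real.sqrt_pos.mpr hpos
  have hsq : Real.sqrt (1 - x ^ 2) ^ 2 = 1 - x ^ 2 := Real.sq_sqrt hpos.le
  have hin : HasDerivAt (fun y : ℝ => 1 - y ^ 2) (-(2 * x)) x := by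
    simpa using (hasDerivAt_pow 2 x).const_sub 1
  have h := ((((hasDerivAt_id x).const_mul (1 / 2)).mul (hin.sqrt hpos.ne')).const_add
    (Real.pi / 4)).sub ((Real.hasDerivAt_arcsin h₀.ne' h₁.ne).const_mul (1 / 2))
  refine HasDerivAt.congr_deriv (f := F) h ?_
  simp only [id]
  field_simp
  linear_combination hsq

theorem F_le {φ : ℝ} (h₀ : 0 ≤ φ) (h₁ : φ < 1) : F φ ≤ Real.pi / 4 - φ ^ 3 / 3 := by
  have hd : ∀ x ∈ Set.Icc 0 φ, HasDerivAt (fun y => F y + y ^ 3 / 3)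
      (-x ^ 2 / Real.sqrt (1 - x ^ 2) + x ^ 2) x := by
    intro x hx
    have h3 : HasDerivAt (fun y : ℝ => y ^ 3 / 3) (x ^ 2) x :=
      ((hasDerivAt_pow 3 x).div_const 3).congr_deriv (by norm_num)
    exact (hasDerivAt_F (by linarith [hx.1]) (by linarith [hx.2])).add h3
  have hanti : AntitoneOn (fun y => F y + y ^ 3 / 3) (Set.Icc 0 φ) := by
    refine antitoneOn_of_deriv_nonpos (convex_Icc 0 φ)
      (fun x hx => (hd x hx).continuousAt.continuousWithinAt)
      (fun x hx => (hd x (interior_subset hx)).differentiableAt.differentiableWithinAt) ?_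
    intro x hx
    have hx := interior_subset hx
    rw [(hd x hx).deriv]
    have hs : 0 < Real.sqrt (1 - x ^ 2) :=
      Real.sqrt_pos.mpr (by nlinarith [hx.1, hx.2])
    have hs1 : Real.sqrt (1 - x ^ 2) ≤ 1 :=
      Real.sqrt_le_one.mpr (by nlinarith [sq_nonneg x])
    have : x ^ 2 ≤ x ^ 2 / Real.sqrt (1 - x ^ 2) := le_div_self (sq_nonneg x) hs hs1
    rw [neg_div]
    linarith
  have h := hanti (Set.left_mem_Icc.mpr h₀) (Set.right_mem_Icc.mpr h₀) h₀
  have hF0 : F 0 = Real.pi / 4 := by simp [F]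
  simp only [hF0] at h
  linarith

theorem F_nonneg {φ : ℝ} (h₀ : 0 ≤ φ) : 0 ≤ F φ := by
  have h1 := Real.arcsin_le_pi_div_two φ
  have h2 : 0 ≤ (1 / 2) * φ * Real.sqrt (1 - φ ^ 2) := by positivity
  unfold F
  linarith

theorem E_le {φ : ℝ} (h₀ : 0 ≤ φ) (h₁ : φ ≤ 4 / 5) :
    E φ ≤ 1 + (φ ^ 2 / (1 + φ)) ^ 2 := by
  have hφ : 0 < 1 + φ := by linarith
  set x := φ ^ 2 / (1 + φ) with hx
  have hx0 : 0 ≤ x := by positivity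
  have hx1 : x ≤ 2 / 5 := by
    rw [hx, div_le_iff₀ hφ]
    nlinarith
  have hq : 1 + φ - φ ^ 2 = (1 + φ) * (1 - x) := by
    rw [hx]
    field_simp
  have hx2 : 0 < 1 - x := by linarith
  have hsqrt : Real.sqrt (1 + φ) / Real.sqrt (1 + φ - φ ^ 2) ≤ 1 + x / 2 + x ^ 2 := by
    rw [hq, ← Real.sqrt_div hφ.le]
    refine Real.sqrt_le_iff.mpr ⟨by positivity, ?_⟩
    rw [div_le_iff₀ (by positivity)]
    have hpoly : 1 ≤ (1 + x / 2 + x ^ 2) ^ 2 * (1 - x) := by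
      have h3 : 0 ≤ 5 / 4 * (1 - x) - x ^ 3 := by
        nlinarith [pow_le_pow_left₀ hx0 hx1 3]
      nlinarith [mul_nonneg (sq_nonneg x) h3]
    nlinarith [mul_le_mul_of_nonneg_left hpoly hφ.le]
  have he : E φ = Real.sqrt (1 + φ) / Real.sqrt (1 + φ - φ ^ 2) - x / 2 := by
    rw [E, hx]
    ring
  linarith

theorem EF_le (φ : ℝ) (hφ : φ ∈ Set.Icc (0:ℝ) (4/5)) :
    E φ * F φ ≤ Real.pi / 4 + (Real.pi / 16 - 1 / 3) * φ ^ 3 := by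
  obtain ⟨h₀, h₁⟩ := hφ
  have hp : 0 < 1 + φ := by linarith
  have hcube : 0 ≤ φ ^ 3 := by positivity
  have hx : (φ ^ 2 / (1 + φ)) ^ 2 ≤ φ ^ 3 / 4 := by
    rw [div_pow, div_le_iff₀ (by positivity)]
    nlinarith [mul_nonneg hcube (sq_nonneg (1 - φ))]
  calc E φ * F φ ≤ (1 + φ ^ 3 / 4) * F φ :=
        mul_le_mul_of_nonneg_right ((E_le h₀ h₁).trans (by linarith)) (F_nonneg h₀)
    _ ≤ (1 + φ ^ 3 / 4) * (Real.pi / 4 - φ ^ 3 / 3) :=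
        mul_le_mul_of_nonneg_left (F_le h₀ (by linarith)) (by positivity)
    _ ≤ Real.pi / 4 + (Real.pi / 16 - 1 / 3) * φ ^ 3 := by
        nlinarith [sq_nonneg (φ ^ 3)]
end

section
/- For every φ in the closed interval [0, 4/5], I₂(φ) ≤ (4/π)·(1/(1+φ³))·[ π/4 + (π/16 − 1/3)·φ³ + (π/4 − 1/2)·φ³ ]. -/
open intervalIntegral

/-- A quadratic majorant of `(1 - x) ^ (-1/2)`, stated without division. -/
theorem one_le_quadratic_mul_sqrt_one_sub {x : ℝ} (h0 : 0 ≤ x) (h1 : x ≤ 16 / 45) :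
    1 ≤ (1 + x / 2 + 9 / 16 * x ^ 2) * √(1 - x) := by
  have hP : 0 < 1 + x / 2 + 9 / 16 * x ^ 2 := by positivity
  rw [← div_le_iff₀' hP]
  apply Real.le_sqrt_of_sq_le
  rw [div_pow, one_pow, div_le_iff₀ (by positivity)]
  have h2 : x ^ 2 ≤ (16 / 45) ^ 2 := by gcongr
  have h3 : x ^ 3 ≤ (16 / 45) ^ 3 := by gcongr
  have hq : 0 ≤ 3 / 8 - 13 / 16 * x - 63 / 256 * x ^ 2 - 81 / 256 * x ^ 3 := by
    norm_num at h2 h3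
    linarith
  nlinarith [mul_nonneg (sq_nonneg x) hq]

/-- The integrand of `I₂` is bounded by its second-order expansion in `a = φ ^ 3`, with an
enlarged quadratic coefficient. -/
theorem I2_integrand_le {a s : ℝ} (ha : 0 ≤ a) (hs0 : 0 < s) (hs1 : s < 1)
    (has : a ≤ 16 / 45 * (s * (1 + s))) :
    s ^ ((5 : ℝ) / 2) / √((1 - s) * (s ^ 2 + s - a)) ≤
      s ^ 2 / √(1 - s ^ 2) + a / 2 * (s / ((1 + s) * √(1 - s ^ 2))) +
        9 / 16 * a ^ 2 * (1 / ((1 + s) ^ 2 * √(1 - s ^ 2))) := by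
  have hw : 0 < √(1 - s ^ 2) := Real.sqrt_pos.2 (by nlinarith)
  have hr : 0 < √s := Real.sqrt_pos.2 hs0
  set x := a / (s * (1 + s)) with hx
  have hx0 : 0 ≤ x := by positivity
  have hx1 : x ≤ 16 / 45 := by rwa [hx, div_le_iff₀ (by positivity)]
  have hax : a = x * (s * (1 + s)) := by rw [hx]; field_simp
  have hy : 0 < √(1 - x) := Real.sqrt_pos.2 (by linarith)
  have hden : √((1 - s) * (s ^ 2 + s - a)) = √s * √(1 - s ^ 2) * √(1 - x) := by
    rw [← Real.sqrt_mul hs0.le, ← Real.sqrt_mul (by nlinarith), hax]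
    congr 1
    ring
  have hnum : s ^ ((5 : ℝ) / 2) = s ^ 2 * √s := by
    rw [Real.sqrt_eq_rpow, ← Real.rpow_natCast s 2, ← Real.rpow_add hs0]
    norm_num
  have hrhs : s ^ 2 / √(1 - s ^ 2) + a / 2 * (s / ((1 + s) * √(1 - s ^ 2))) +
        9 / 16 * a ^ 2 * (1 / ((1 + s) ^ 2 * √(1 - s ^ 2))) =
      s ^ 2 / √(1 - s ^ 2) * (1 + x / 2 + 9 / 16 * x ^ 2) := by
    rw [hax]
    field_simp
  have hlhs : s ^ 2 * √s / (√s * √(1 - s ^ 2) * √(1 - x)) =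
      s ^ 2 / √(1 - s ^ 2) * (1 / √(1 - x)) := by
    field_simp
  rw [hden, hnum, hrhs, hlhs]
  gcongr
  rw [div_le_iff₀ hy]
  exact one_le_quadratic_mul_sqrt_one_sub hx0 hx1

/-- An antiderivative of the majorant in `I2_integrand_le`. -/
noncomputable def I2Primitive (a s : ℝ) : ℝ :=
  (Real.arcsin s - s * √(1 - s ^ 2)) / 2 + a / 2 * (Real.arcsin s + √(1 - s ^ 2) / (1 + s)) -
    9 / 16 * a ^ 2 * ((√(1 - s ^ 2) / (1 + s) + (√(1 - s ^ 2) / (1 + s)) ^ 3 / 3) / 2)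

theorem hasDerivAt_sqrt_one_sub_sq_s10 {s : ℝ} (hs : -1 < s) (hs1 : s < 1) :
    HasDerivAt (fun s : ℝ => √(1 - s ^ 2)) (-s / √(1 - s ^ 2)) s := by
  have h := (((hasDerivAt_id s).pow 2).const_sub 1).sqrt
    (by simp only [Pi.pow_apply, id]; nlinarith)
  convert h using 1
  simp only [Pi.pow_apply, id]
  field_simp
  norm_num
  ring

theorem hasDerivAt_arcsin_sub_mul_sqrt {s : ℝ} (hs : -1 < s) (hs1 : s < 1) :
    HasDerivAt (fun s : ℝ => Real.arcsin s - s * √(1 - s ^ 2)) (2 * s ^ 2 / √(1 - s ^ 2)) s := by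
  have hw : 0 < √(1 - s ^ 2) := Real.sqrt_pos.2 (by nlinarith)
  have hw2 : √(1 - s ^ 2) ^ 2 = 1 - s ^ 2 := Real.sq_sqrt (by nlinarith)
  have h := (Real.hasDerivAt_arcsin hs.ne' hs1.ne).sub
    ((hasDerivAt_id s).mul (hasDerivAt_sqrt_one_sub_sq_s10 hs hs1))
  refine h.congr_deriv ?_
  simp only [id]
  field_simp
  rw [hw2]
  ring

theorem hasDerivAt_sqrt_one_sub_sq_div {s : ℝ} (hs : -1 < s) (hs1 : s < 1) :
    HasDerivAt (fun s : ℝ => √(1 - s ^ 2) / (1 + s)) (-1 / ((1 + s) * √(1 - s ^ 2))) s := by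
  have hw : 0 < √(1 - s ^ 2) := Real.sqrt_pos.2 (by nlinarith)
  have hw2 : √(1 - s ^ 2) ^ 2 = 1 - s ^ 2 := Real.sq_sqrt (by nlinarith)
  have hp : 0 < 1 + s := by linarith
  have h := (hasDerivAt_sqrt_one_sub_sq_s10 hs hs1).div ((hasDerivAt_id s).const_add 1) hp.ne'
  refine h.congr_deriv ?_
  simp only [id]
  field_simp
  rw [hw2]
  ring

theorem hasDerivAt_I2Primitive (a : ℝ) {s : ℝ} (hs : -1 < s) (hs1 : s < 1) :
    HasDerivAt (I2Primitive a)
      (s ^ 2 / √(1 - s ^ 2) + a / 2 * (s / ((1 + s) * √(1 - s ^ 2))) +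
        9 / 16 * a ^ 2 * (1 / ((1 + s) ^ 2 * √(1 - s ^ 2)))) s := by
  have hw : 0 < √(1 - s ^ 2) := Real.sqrt_pos.2 (by nlinarith)
  have hw2 : √(1 - s ^ 2) ^ 2 = 1 - s ^ 2 := Real.sq_sqrt (by nlinarith)
  have hp : 0 < 1 + s := by linarith
  have hu := hasDerivAt_sqrt_one_sub_sq_div hs hs1
  have h := (((hasDerivAt_arcsin_sub_mul_sqrt hs hs1).div_const 2).add
    (((Real.hasDerivAt_arcsin hs.ne' hs1.ne).add hu).const_mul (a / 2))).sub
    (((hu.add ((hu.pow 3).div_const 3)).div_const 2).const_mul (9 / 16 * a ^ 2))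
  refine h.congr_deriv ?_
  have hu2 : (√(1 - s ^ 2) / (1 + s)) ^ 2 = (1 - s) / (1 + s) := by
    rw [div_pow, hw2]
    field_simp
    ring
  simp only [Nat.cast_ofNat, Nat.add_one_sub_one, hu2]
  field_simp
  ring

theorem continuousOn_I2Primitive (a : ℝ) : ContinuousOn (I2Primitive a) (Set.Ici 0) := by
  have hp : ∀ s ∈ Set.Ici (0 : ℝ), 1 + s ≠ 0 := fun s hs => by
    have : (0 : ℝ) ≤ s := hs
    positivity
  have hu : ContinuousOn (fun s : ℝ => √(1 - s ^ 2) / (1 + s)) (Set.Ici 0) :=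
    ContinuousOn.div (by fun_prop) (by fun_prop) hp
  have harc : ContinuousOn Real.arcsin (Set.Ici 0) := Real.continuous_arcsin.continuousOn
  unfold I2Primitive
  fun_prop

theorem two_thirds_mul_cube_le_arcsin_sub {x : ℝ} (h0 : 0 ≤ x) (h1 : x ≤ 1) :
    2 / 3 * x ^ 3 ≤ Real.arcsin x - x * √(1 - x ^ 2) := by
  have hmono : MonotoneOn (fun s : ℝ => Real.arcsin s - s * √(1 - s ^ 2) - 2 / 3 * s ^ 3)
      (Set.Icc 0 1) := by
    refine monotoneOn_of_hasDerivWithinAt_nonneg (convex_Icc 0 1)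
      (f' := fun s => 2 * s ^ 2 / √(1 - s ^ 2) - 2 * s ^ 2) ?_ ?_ ?_
    · have := Real.continuous_arcsin
      fun_prop
    · intro s hs
      rw [interior_Icc] at hs
      refine (((hasDerivAt_arcsin_sub_mul_sqrt (by linarith [hs.1]) hs.2).sub
        ((hasDerivAt_pow 3 s).const_mul (2 / 3))).congr_deriv ?_).hasDerivWithinAt
      norm_num
      ring
    · intro s hs
      rw [interior_Icc] at hs
      have hw : 0 < √(1 - s ^ 2) := Real.sqrt_pos.2 (by nlinarith [hs.1, hs.2])
      have hw1 : √(1 - s ^ 2) ≤ 1 := Real.sqrt_le_one.2 (by nlinarith [sq_nonneg s])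
      rw [sub_nonneg, le_div_iff₀ hw]
      exact mul_le_of_le_one_right (by positivity) hw1
  have h := hmono ⟨le_rfl, zero_le_one⟩ ⟨h0, h1⟩ h0
  simp only [Real.arcsin_zero] at h
  norm_num at h
  linarith

theorem one_sub_le_sqrt_one_sub_sq_div {x : ℝ} (h0 : 0 ≤ x) (h1 : x ≤ 1) :
    1 - x ≤ √(1 - x ^ 2) / (1 + x) := by
  rw [le_div_iff₀ (by positivity)]
  apply Real.le_sqrt_of_sq_le
  nlinarith [mul_nonneg (sub_nonneg.2 h1) h0, sq_nonneg x]

theorem le_I2Primitive {φ : ℝ} (h0 : 0 ≤ φ) (h1 : φ ≤ 4 / 5) :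
    φ ^ 3 / 3 + φ ^ 3 / 2 - Real.pi / 16 * φ ^ 3 ≤ I2Primitive (φ ^ 3) φ := by
  have hA := two_thirds_mul_cube_le_arcsin_sub h0 (by linarith)
  have hφ : φ ≤ Real.arcsin φ := by
    rw [Real.le_arcsin_iff_sin_le' ⟨by linarith [Real.pi_gt_three], by linarith [Real.pi_gt_three]⟩]
    exact Real.sin_le h0
  have hu := one_sub_le_sqrt_one_sub_sq_div h0 (by linarith)
  have hu0 : 0 ≤ √(1 - φ ^ 2) / (1 + φ) := by positivity
  have hu1 : √(1 - φ ^ 2) / (1 + φ) ≤ 1 := by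
    rw [div_le_one (by positivity)]
    have : √(1 - φ ^ 2) ≤ 1 := Real.sqrt_le_one.2 (by nlinarith [sq_nonneg φ])
    linarith
  unfold I2Primitive
  set u := √(1 - φ ^ 2) / (1 + φ)
  have hu3 : u ^ 3 ≤ 1 := pow_le_one₀ hu0 hu1
  have ha0 : 0 ≤ φ ^ 3 := by positivity
  have ha1 : φ ^ 3 ≤ (4 / 5) ^ 3 := by gcongr
  set a := φ ^ 3
  have hB : a / 2 * 1 ≤ a / 2 * (Real.arcsin φ + u) := by
    gcongr
    linarith
  have hC : 9 / 16 * a ^ 2 * ((u + u ^ 3 / 3) / 2) ≤ 9 / 16 * a ^ 2 * (2 / 3) := by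
    refine mul_le_mul_of_nonneg_left ?_ (by positivity)
    linarith
  have hD : 9 / 16 * a ^ 2 * (2 / 3) ≤ Real.pi / 16 * a := by
    have : 9 / 16 * (2 / 3) * a ≤ Real.pi / 16 := by
      norm_num at ha1
      linarith [Real.pi_gt_d2]
    nlinarith
  linarith

theorem I2Primitive_one (a : ℝ) : I2Primitive a 1 = Real.pi / 4 + Real.pi / 4 * a := by
  simp [I2Primitive]
  ring

theorem I2_integral_le {φ : ℝ} (h0 : 0 ≤ φ) (h1 : φ ≤ 4 / 5) :
    ∫ s in φ..1, s ^ ((5 : ℝ) / 2) / √((1 - s) * (s ^ 2 + s - φ ^ 3)) ≤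
      I2Primitive (φ ^ 3) 1 - I2Primitive (φ ^ 3) φ := by
  have hφ1 : φ ≤ 1 := by linarith
  have ha : 0 ≤ φ ^ 3 := by positivity
  have hcont : ContinuousOn (I2Primitive (φ ^ 3)) (Set.Icc φ 1) :=
    (continuousOn_I2Primitive _).mono fun s hs => h0.trans hs.1
  have hderiv := fun s (hs : s ∈ Set.Ioo φ 1) =>
    hasDerivAt_I2Primitive (φ ^ 3) (s := s) (by linarith [hs.1]) hs.2
  have hint := intervalIntegral.integrableOn_deriv_of_nonneg hcont hderiv fun s hs => by
    have : 0 < s := h0.trans_lt hs.1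
    positivity
  rw [← integral_eq_sub_of_hasDerivAt_of_le hφ1 hcont hderiv
      ((intervalIntegrable_iff_integrableOn_Ioc_of_le hφ1).2 hint),
    integral_of_le hφ1, integral_of_le hφ1, MeasureTheory.integral_Ioc_eq_integral_Ioo,
    MeasureTheory.integral_Ioc_eq_integral_Ioo]
  refine MeasureTheory.integral_mono_of_nonneg ?_ (hint.mono_set Set.Ioo_subset_Ioc_self) ?_
  · refine (MeasureTheory.ae_restrict_iff' measurableSet_Ioo).2 (.of_forall fun s hs => ?_)
    have : 0 < s := h0.trans_lt hs.1
    simp only [Pi.zero_apply]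
    positivity
  · refine (MeasureTheory.ae_restrict_iff' measurableSet_Ioo).2 (.of_forall fun s hs => ?_)
    refine I2_integrand_le ha (h0.trans_lt hs.1) hs.2 ?_
    calc φ ^ 3 ≤ 16 / 45 * (φ * (1 + φ)) := by
          nlinarith [mul_nonneg h0 (mul_nonneg (sub_nonneg.2 h1) (by positivity : 0 ≤ 9 * φ + 4))]
      _ ≤ 16 / 45 * (s * (1 + s)) := by
          have := hs.1.le
          have := h0.trans this
          gcongr

theorem I2_le (φ : ℝ) (hφ : φ ∈ Set.Icc (0:ℝ) (4/5)) :
    I₂ φ ≤ (4 / Real.pi) * (1 / (1 + φ ^ 3)) *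
      (Real.pi / 4 + (Real.pi / 16 - 1 / 3) * φ ^ 3 + (Real.pi / 4 - 1 / 2) * φ ^ 3) := by
  obtain ⟨h0, h1⟩ := hφ
  unfold I₂
  have hJ := I2_integral_le h0 h1
  rw [I2Primitive_one] at hJ
  have hH := le_I2Primitive h0 h1
  have hpi := Real.pi_pos
  gcongr
  linarith
end

section
/- For every y with 0 < y ≤ (2π)^{3/2}, ∫_0^y (36π − (27/2)·y^{2/3} − (9/2)·x^{2/3})^{−1/2} dx = (√2/2)·(8π − 3·y^{2/3})·[ arcsin( y^{1/3} / √(8π − 3·y^{2/3}) ) − 2·y^{1/3}·√(2π − y^{2/3}) / (8π − 3·y^{2/3}) ]. -/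
open Real intervalIntegral

/-- An antiderivative of `t ↦ t ^ 2 / √(A - t ^ 2)`. -/
lemma hasDerivAt_arcsin_sub_mul_sqrt_s19 {A t : ℝ} (h : t ^ 2 < A) :
    HasDerivAt (fun t => (A * arcsin (t / √A) - t * √(A - t ^ 2)) / 2)
      (t ^ 2 / √(A - t ^ 2)) t := by
  have hA : 0 < A := (sq_nonneg t).trans_lt h
  have hs : 0 < √A := sqrt_pos.2 hA
  have hr : 0 < √(A - t ^ 2) := sqrt_pos.2 (sub_pos.2 h)
  have hs2 : √A ^ 2 = A := sq_sqrt hA.le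
  have hr2 : √(A - t ^ 2) ^ 2 = A - t ^ 2 := sq_sqrt (sub_pos.2 h).le
  have hu : (t / √A) ^ 2 < 1 := by rw [div_pow, hs2, div_lt_one hA]; exact h
  have hroot : √(1 - (t / √A) ^ 2) = √(A - t ^ 2) / √A := by
    rw [← sqrt_div (sub_pos.2 h).le, div_pow, hs2, sub_div, div_self hA.ne']
  have h1 : HasDerivAt (fun t => arcsin (t / √A)) (1 / √(1 - (t / √A) ^ 2) * (1 / √A)) t :=
    (hasDerivAt_arcsin (by nlinarith) (by nlinarith)).comp t ((hasDerivAt_id t).div_const _)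
  have h2 : HasDerivAt (fun t => √(A - t ^ 2)) (-(2 * t) / (2 * √(A - t ^ 2))) t := by
    have := ((hasDerivAt_pow 2 t).const_sub A).sqrt (sub_pos.2 h).ne'
    simpa using this
  refine HasDerivAt.congr_deriv (((h1.const_mul A).sub ((hasDerivAt_id' t).mul h2)).div_const 2) ?_
  rw [hroot]
  generalize √(A - t ^ 2) = r at *
  field_simp
  linear_combination -hr2

lemma integral_rpow_neg_half_sub_rpow_two_thirds {A y : ℝ} (hy : 0 < y)
    (h : (y ^ ((1:ℝ)/3)) ^ 2 ≤ A) :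
    ∫ x in (0:ℝ)..y, (9 / 2 * (A - (x ^ ((1:ℝ)/3)) ^ 2)) ^ (-(1:ℝ)/2)
      = √2 * ((A * arcsin (y ^ ((1:ℝ)/3) / √A)
          - y ^ ((1:ℝ)/3) * √(A - (y ^ ((1:ℝ)/3)) ^ 2)) / 2) := by
  have hcont : Continuous fun x : ℝ => x ^ ((1:ℝ)/3) :=
    continuous_id.rpow_const fun _ => Or.inr (by norm_num)
  set F : ℝ → ℝ := fun x => √2 * ((A * arcsin (x ^ ((1:ℝ)/3) / √A)
    - x ^ ((1:ℝ)/3) * √(A - (x ^ ((1:ℝ)/3)) ^ 2)) / 2) with hF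
  have hFc : Continuous F := by
    have := continuous_arcsin.comp (hcont.div_const √A)
    simp only [Function.comp_def] at this
    fun_prop
  have hlt : ∀ x ∈ Set.Ioo 0 y, (x ^ ((1:ℝ)/3)) ^ 2 < A := fun x hx =>
    (pow_lt_pow_left₀ (rpow_lt_rpow hx.1.le hx.2 (by norm_num))
      (rpow_nonneg hx.1.le _) two_ne_zero).trans_le h
  have hd : ∀ x ∈ Set.Ioo 0 y,
      HasDerivAt F ((9 / 2 * (A - (x ^ ((1:ℝ)/3)) ^ 2)) ^ (-(1:ℝ)/2)) x := by
    intro x hx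
    have hroot : HasDerivAt (fun x : ℝ => x ^ ((1:ℝ)/3)) (1 / 3 * x ^ ((1:ℝ)/3 - 1)) x :=
      hasDerivAt_rpow_const (Or.inl hx.1.ne')
    have hcomp := ((hasDerivAt_arcsin_sub_mul_sqrt_s19 (hlt x hx)).comp x hroot).const_mul √2
    refine HasDerivAt.congr_deriv (f := F) hcomp ?_
    have hpow : x ^ ((1:ℝ)/3 - 1) = ((x ^ ((1:ℝ)/3)) ^ 2)⁻¹ := by
      rw [← rpow_natCast, ← rpow_mul hx.1.le, ← rpow_neg hx.1.le]; norm_num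
    have ht : 0 < x ^ ((1:ℝ)/3) := rpow_pos_of_pos hx.1 _
    have hpos := sub_pos.2 (hlt x hx)
    have h9 : √(9 / 2) = 3 / √2 := by
      rw [sqrt_div (by norm_num), show (9:ℝ) = 3 ^ 2 by norm_num, sqrt_sq (by norm_num)]
    rw [hpow, neg_div, rpow_neg (by positivity), ← sqrt_eq_rpow, sqrt_mul (by norm_num), h9]
    have := sqrt_pos.2 hpos
    field_simp
  have hint : IntervalIntegrable
      (fun x => (9 / 2 * (A - (x ^ ((1:ℝ)/3)) ^ 2)) ^ (-(1:ℝ)/2)) MeasureTheory.volume 0 y := by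
    refine intervalIntegrable_deriv_of_nonneg hFc.continuousOn ?_ ?_ <;>
      rw [min_eq_left hy.le, max_eq_right hy.le]
    · exact hd
    · intro x hx
      have := sub_pos.2 (hlt x hx)
      positivity
  rw [integral_eq_sub_of_hasDerivAt_of_le hy.le hFc.continuousOn hd hint]
  simp [hF]

theorem I1_closed_form (y : ℝ) (hy : 0 < y) (hy' : y ≤ (2 * Real.pi) ^ ((3:ℝ)/2)) :
    (∫ x in (0:ℝ)..y,
        (36 * Real.pi - (27 / 2) * y ^ ((2:ℝ)/3) - (9 / 2) * x ^ ((2:ℝ)/3)) ^ (-(1:ℝ)/2))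
      = (Real.sqrt 2 / 2) * (8 * Real.pi - 3 * y ^ ((2:ℝ)/3)) *
        (Real.arcsin (y ^ ((1:ℝ)/3) / Real.sqrt (8 * Real.pi - 3 * y ^ ((2:ℝ)/3)))
          - 2 * y ^ ((1:ℝ)/3) * Real.sqrt (2 * Real.pi - y ^ ((2:ℝ)/3))
            / (8 * Real.pi - 3 * y ^ ((2:ℝ)/3))) := by
  have hsq : ∀ x : ℝ, 0 ≤ x → (x ^ ((1:ℝ)/3)) ^ 2 = x ^ ((2:ℝ)/3) := by
    intro x hx
    rw [← rpow_natCast, ← rpow_mul hx]; norm_num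
  have hY : y ^ ((2:ℝ)/3) ≤ 2 * π := by
    calc y ^ ((2:ℝ)/3) ≤ ((2 * π) ^ ((3:ℝ)/2)) ^ ((2:ℝ)/3) :=
          rpow_le_rpow hy.le hy' (by norm_num)
      _ = 2 * π := by rw [← rpow_mul (by positivity)]; norm_num
  have hA : 0 < 8 * π - 3 * y ^ ((2:ℝ)/3) := by linarith [pi_pos]
  have hsqrt : √(8 * π - 3 * y ^ ((2:ℝ)/3) - y ^ ((2:ℝ)/3)) = 2 * √(2 * π - y ^ ((2:ℝ)/3)) := by
    rw [show 8 * π - 3 * y ^ ((2:ℝ)/3) - y ^ ((2:ℝ)/3) = 2 ^ 2 * (2 * π - y ^ ((2:ℝ)/3)) by ring,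
      sqrt_mul (by norm_num), sqrt_sq (by norm_num)]
  have key := integral_rpow_neg_half_sub_rpow_two_thirds (A := 8 * π - 3 * y ^ ((2:ℝ)/3)) hy
    (by rw [hsq y hy.le]; linarith)
  rw [hsq y hy.le, hsqrt] at key
  rw [integral_congr (g := fun x => (9 / 2 * (8 * π - 3 * y ^ ((2:ℝ)/3)
    - (x ^ ((1:ℝ)/3)) ^ 2)) ^ (-(1:ℝ)/2)), key]
  · field_simp
  · intro x hx
    rw [Set.uIcc_of_le hy.le] at hx
    simp only [hsq x hx.1]
    congr 1
    ring
end
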